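/- There exists a subgroup G ≤ W isomorphic to the dihedral group of order 30 such that: the action of G on the 56 exceptional classes has exactly four orbits, of lengths 6, 10, 10, and 30, with point stabilizers cyclic of orders 5, 3, 3, and 1 respectively; G is minimal; G fixes no conic class; and G satisfies condition (H1). -/

import Mathlib

open scoped BigOperators

noncomputable section

/-- The Picard lattice of a degree 2 del Pezzo surface. -/
abbrev V : Type := Fin 8 → ℤ

/-- The intersection form. -/
def bil (x y : V) : ℤ := x 0 * y 0 - ∑ i ∈ Finset.Ioi (0 : Fin 8), x i * y i

/-- The canonical class. -/
def Kvec : V := fun i => if i = 0 then -3 else 1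

abbrev LatAut := V ≃ₗ[ℤ] V

/-- The Weyl group: automorphisms preserving the form and fixing K. -/
def W : Subgroup LatAut where
  carrier := {g | (∀ x y, bil (g x) (g y) = bil x y) ∧ g Kvec = Kvec}
  one_mem' := ⟨fun _ _ => rfl, rfl⟩
  mul_mem' := by
    rintro a b ⟨ha1, ha2⟩ ⟨hb1, hb2⟩
    refine ⟨fun x y => ?_, ?_⟩
    · show bil (a (b x)) (a (b y)) = bil x y
      rw [ha1, hb1]
    · show a (b Kvec) = Kvec
      rw [hb2, ha2]
  inv_mem' := by
    rintro a ⟨ha1, ha2⟩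
    refine ⟨fun x y => ?_, ?_⟩
    · have h := ha1 (a⁻¹ x) (a⁻¹ y)
      have hx : a (a⁻¹ x) = x := a.apply_symm_apply x
      have hy : a (a⁻¹ y) = y := a.apply_symm_apply y
      rw [hx, hy] at h
      exact h.symm
    · have h2 : a.symm (a Kvec) = a.symm Kvec := by rw [ha2]
      rw [a.symm_apply_apply] at h2
      exact (show a⁻¹ Kvec = a.symm Kvec from rfl).trans h2.symm

/-- Exceptional classes. -/
def Exc : Set V := {E | bil E E = -1 ∧ bil E Kvec = -1}

/-- Conic classes. -/
def IsConic (C : V) : Prop := bil C C = 0 ∧ bil C Kvec = -2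

/-- The orbit of a vector under a subgroup of `LatAut`. -/
def orb (G : Subgroup LatAut) (E : V) : Set V := {v | ∃ g ∈ G, g E = v}

/-- The set of orbits of exceptional classes. -/
def orbs (G : Subgroup LatAut) : Set (Set V) := {S | ∃ E ∈ Exc, S = orb G E}

/-- The stabilizer of a vector, as a subgroup of `LatAut`. -/
def stab (G : Subgroup LatAut) (E : V) : Subgroup LatAut where
  carrier := {g | g ∈ G ∧ g E = E}
  one_mem' := ⟨G.one_mem, rfl⟩
  mul_mem' := by
    rintro a b ⟨haG, ha⟩ ⟨hbG, hb⟩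
    exact ⟨G.mul_mem haG hbG, by show a (b E) = E; rw [hb, ha]⟩
  inv_mem' := by
    rintro a ⟨haG, ha⟩
    refine ⟨G.inv_mem haG, ?_⟩
    conv_lhs => rw [← ha]
    exact a.symm_apply_apply E

/-- `G` is minimal: no nonempty orbit of exceptional classes consists of pairwise
orthogonal classes. -/
def MinimalAction (G : Subgroup LatAut) : Prop :=
  ∀ E ∈ Exc, ¬ (∀ E₁ ∈ orb G E, ∀ E₂ ∈ orb G E, E₁ ≠ E₂ → bil E₁ E₂ = 0)

/-- The natural representation of a subgroup of `LatAut` on the lattice. -/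
def rep (G : Subgroup LatAut) : Representation ℤ G V where
  toFun g := (g : LatAut).toLinearMap
  map_one' := rfl
  map_mul' _ _ := rfl

/-- Condition (H1): the first group cohomology of every subgroup of `G`
with coefficients in the lattice vanishes. -/
def CondH1 (G : Subgroup LatAut) : Prop :=
  ∀ G' : Subgroup LatAut, G' ≤ G →
    Subsingleton (groupCohomology.H1 (Rep.of (rep G')))

theorem bil_eq (x y : V) : bil x y = x 0 * y 0 - (x 1 * y 1 + x 2 * y 2 + x 3 * y 3 + x 4 * y 4 +
    x 5 * y 5 + x 6 * y 6 + x 7 * y 7) := by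
  have h : Finset.Ioi (0 : Fin 8) = {1, 2, 3, 4, 5, 6, 7} := by decide
  simp [bil, h]
  ring

theorem bil_add_left (x y z : V) : bil (x + y) z = bil x z + bil y z := by
  simp only [bil_eq, Pi.add_apply]
  ring

theorem bil_smul_left (c : ℤ) (x y : V) : bil (c • x) y = c * bil x y := by
  simp only [bil_eq, Pi.smul_apply, smul_eq_mul]
  ring

theorem bil_apply_inv {g : LatAut} (hg : g ∈ W) (x y : V) : bil (g x) y = bil x (g⁻¹ y) := by
  rw [← hg.1 x (g⁻¹ y)]
  exact congrArg (bil (g x)) (g.apply_symm_apply y).symm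

/-! ### Homomorphisms out of a dihedral group -/

section DihedralLift

variable {M : Type*} [Group M] {n : ℕ} [NeZero n] {a b : M}

theorem pow_zmod_val_add (ha : a ^ n = 1) (i j : ZMod n) :
    a ^ (i + j).val = a ^ i.val * a ^ j.val := by
  rw [ZMod.val_add, ← pow_add, ← pow_eq_pow_mod _ ha]

theorem pow_zmod_val_sub (ha : a ^ n = 1) (i j : ZMod n) :
    a ^ (j - i).val = (a ^ i.val)⁻¹ * a ^ j.val := by
  rw [eq_inv_mul_iff_mul_eq, ← pow_zmod_val_add ha, add_sub_cancel]

theorem pow_mul_of_inverts (hb : b * b = 1) (hab : b * a * b = a⁻¹) (k : ℕ) :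
    a ^ k * b = b * (a ^ k)⁻¹ := by
  have hinv : b⁻¹ = b := inv_eq_of_mul_eq_one_left hb
  have h : b * a ^ k * b = (a ^ k)⁻¹ := by
    have := conj_pow (i := k) (a := b) (b := a)
    rw [hinv, hab] at this
    rw [← this, inv_pow]
  rw [← h, ← mul_assoc, ← mul_assoc, hb, one_mul]

/-- The homomorphism from the dihedral group of order `2 * n` determined by the images `a` of the
rotation and `b` of the reflection. -/
def dihedralLift (ha : a ^ n = 1) (hb : b * b = 1) (hab : b * a * b = a⁻¹) :
    DihedralGroup n →* M :=
  MonoidHom.mk'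
    (fun d => match d with
      | .r i => a ^ i.val
      | .sr i => b * a ^ i.val) <| by
    rintro (i | i) (j | j)
    · exact pow_zmod_val_add ha i j
    · change b * a ^ (j - i).val = a ^ i.val * (b * a ^ j.val)
      rw [pow_zmod_val_sub ha, ← mul_assoc, ← mul_assoc, pow_mul_of_inverts hb hab]
    · change b * a ^ (i + j).val = b * a ^ i.val * a ^ j.val
      rw [pow_zmod_val_add ha, mul_assoc]
    · change a ^ (j - i).val = b * a ^ i.val * (b * a ^ j.val)
      rw [pow_zmod_val_sub ha, mul_assoc b, ← mul_assoc _ b, pow_mul_of_inverts hb hab,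
        mul_assoc b, ← mul_assoc b b, hb, one_mul]

end DihedralLift

/-! ### The group -/

/-- The isometry of order 15: identifying the 28 pairs of exceptional classes interchanged by the
Geiser involution with the 2-element subsets of `{1, …, 8}`, it acts as `(1 2 3 4 5)(6 7 8)`. -/
def rotFun (x : V) : V :=
  ![5 * x 0 + 2 * (x 1 + x 2 + x 3 + x 4 + x 5 + x 6),
    -2 * x 0 - x 1 - x 2 - x 3 - x 4 - x 6,
    -2 * x 0 - x 2 - x 3 - x 4 - x 5 - x 6,
    -2 * x 0 - x 1 - x 3 - x 4 - x 5 - x 6,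
    -2 * x 0 - x 1 - x 2 - x 4 - x 5 - x 6,
    -2 * x 0 - x 1 - x 2 - x 3 - x 5 - x 6,
    x 7,
    -2 * x 0 - x 1 - x 2 - x 3 - x 4 - x 5]

/-- The Geiser involution composed with the permutation `(2 5)(3 4)(6 7)` of the coordinates. -/
def reflFun (x : V) : V :=
  let m := -3 * x 0 - (x 1 + x 2 + x 3 + x 4 + x 5 + x 6 + x 7)
  ![-3 * m - x 0, m - x 1, m - x 5, m - x 4, m - x 3, m - x 2, m - x 7, m - x 6]

theorem reflFun_reflFun (x : V) : reflFun (reflFun x) = x := by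
  ext i; fin_cases i <;> simp [reflFun] <;> ring

theorem reflFun_rotFun (x : V) : reflFun (rotFun x) =
    ![4 * x 0 + (x 1 + x 2 + x 3 + x 4 + x 5 + x 6) + 3 * x 7, -x 0 - x 5 - x 7,
      -x 0 - x 4 - x 7, -x 0 - x 3 - x 7, -x 0 - x 2 - x 7, -x 0 - x 1 - x 7, -x 0 - x 6 - x 7,
      -3 * x 0 - (x 1 + x 2 + x 3 + x 4 + x 5 + x 6) - 2 * x 7] := by
  ext i; fin_cases i <;> simp [reflFun, rotFun] <;> ring

theorem reflFun_rotFun_sq (x : V) : reflFun (rotFun (reflFun (rotFun x))) = x := by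
  rw [reflFun_rotFun, reflFun_rotFun]
  ext i; fin_cases i <;> simp <;> ring

/-- `reflFun` as a lattice automorphism. -/
def reflAut : LatAut where
  toFun := reflFun
  map_add' x y := by ext i; fin_cases i <;> simp [reflFun] <;> ring
  map_smul' c x := by ext i; fin_cases i <;> simp [reflFun] <;> ring
  invFun := reflFun
  left_inv := reflFun_reflFun
  right_inv := reflFun_reflFun

/-- `rotFun` as a lattice automorphism. -/
def rotAut : LatAut where
  toFun := rotFun
  map_add' x y := by ext i; fin_cases i <;> simp [rotFun] <;> ring
  map_smul' c x := by ext i; fin_cases i <;> simp [rotFun] <;> ring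
  invFun x := reflFun (rotFun (reflFun x))
  left_inv := reflFun_rotFun_sq
  right_inv x := by
    have h := congrArg reflFun (reflFun_rotFun_sq (reflFun x))
    rwa [reflFun_reflFun, reflFun_reflFun] at h

theorem rotAut_pow_apply (k : ℕ) (x : V) : (rotAut ^ k) x = rotFun^[k] x := by
  induction k generalizing x with
  | zero => rfl
  | succ k ih =>
    rw [pow_succ, Function.iterate_succ_apply, ← ih]
    rfl

theorem rotAut_pow_fifteen : rotAut ^ 15 = 1 := by
  have h : ∀ i : Fin 8, rotFun^[15] (Pi.single i 1) = Pi.single i 1 := by decide +kernel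
  refine LinearEquiv.toLinearMap_injective ((Pi.basisFun ℤ (Fin 8)).ext fun i => ?_)
  rw [Pi.basisFun_apply]
  exact (rotAut_pow_apply _ _).trans (h i)

theorem reflAut_mul_reflAut : reflAut * reflAut = 1 :=
  LinearEquiv.ext reflFun_reflFun

theorem reflAut_mul_rotAut_mul_reflAut : reflAut * rotAut * reflAut = rotAut⁻¹ :=
  LinearEquiv.ext fun _ => rfl

theorem rotAut_mem_W : rotAut ∈ W := by
  refine ⟨fun x y => ?_, by decide +kernel⟩
  change bil (rotFun x) (rotFun y) = _
  simp [bil_eq, rotFun]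
  ring

theorem reflAut_mem_W : reflAut ∈ W := by
  refine ⟨fun x y => ?_, by decide +kernel⟩
  change bil (reflFun x) (reflFun y) = _
  simp [bil_eq, reflFun]
  ring

/-- The action of the dihedral group of order 30 on the lattice. -/
def dihedralHom : DihedralGroup 15 →* LatAut :=
  dihedralLift rotAut_pow_fifteen reflAut_mul_reflAut reflAut_mul_rotAut_mul_reflAut

/-- The underlying functions of `dihedralHom`, in a form suitable for evaluation. -/
def act : DihedralGroup 15 → V → V
  | .r i => rotFun^[i.val]
  | .sr i => fun x => reflFun (rotFun^[i.val] x)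

theorem dihedralHom_apply (d : DihedralGroup 15) (x : V) : dihedralHom d x = act d x := by
  rcases d with i | i
  · exact rotAut_pow_apply _ _
  · exact congrArg reflFun (rotAut_pow_apply _ _)

theorem dihedralHom_mem_W (d : DihedralGroup 15) : dihedralHom d ∈ W := by
  rcases d with i | i
  · exact W.pow_mem rotAut_mem_W _
  · exact W.mul_mem reflAut_mem_W (W.pow_mem rotAut_mem_W _)

theorem range_dihedralHom_le_W : dihedralHom.range ≤ W := by
  rintro _ ⟨d, rfl⟩
  exact dihedralHom_mem_W d

theorem act_mul (d d' : DihedralGroup 15) (x : V) : act (d * d') x = act d (act d' x) := by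
  simp only [← dihedralHom_apply, map_mul]
  rfl

theorem act_inv_act (d : DihedralGroup 15) (x : V) : act d⁻¹ (act d x) = x := by
  rw [← act_mul, inv_mul_cancel]
  rfl

/-- The orbit of a vector as a finset. -/
def orbFinset (E : V) : Finset V := Finset.univ.image fun d => act d E

theorem orb_range_dihedralHom (E : V) : orb dihedralHom.range E = orbFinset E := by
  ext v
  simp [orb, orbFinset, dihedralHom_apply]

theorem orb_act (d : DihedralGroup 15) (E : V) :
    orb dihedralHom.range (act d E) = orb dihedralHom.range E := by
  ext v
  simp only [orb_range_dihedralHom, orbFinset, Finset.coe_image, Finset.coe_univ, Set.image_univ,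
    Set.mem_range]
  constructor
  · rintro ⟨c, rfl⟩
    exact ⟨c * d, act_mul c d E⟩
  · rintro ⟨c, rfl⟩
    exact ⟨c * d⁻¹, by rw [act_mul, act_inv_act]⟩

/-! ### Orbits of exceptional classes -/

/-- Representatives of the orbits of exceptional classes. -/
def excRep : Fin 4 → V :=
  ![![0, 0, 0, 0, 0, 0, 0, 1], ![0, 0, 0, 0, 0, 1, 0, 0], ![1, -1, -1, 0, 0, 0, 0, 0],
    ![1, -1, 0, -1, 0, 0, 0, 0]]

theorem card_orbFinset_excRep : ∀ j, (orbFinset (excRep j)).card = ![6, 30, 10, 10] j := by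
  decide +kernel

theorem orbFinset_excRep_injective : Function.Injective fun j => orbFinset (excRep j) := by
  unfold Function.Injective
  decide +kernel

theorem dihedralHom_injective : Function.Injective dihedralHom := by
  have h : Function.Injective fun d => act d (excRep 1) := by
    rw [← Set.injOn_univ, ← Finset.coe_univ, ← Finset.card_image_iff]
    exact card_orbFinset_excRep 1
  intro c d hcd
  refine h ?_
  simp only [← dihedralHom_apply, hcd]

/-- The vector with first coordinate `n` and the others `-⌈n / 2⌉` or `1 - ⌈n / 2⌉`. -/
def excCandidate (n : Fin 4) (s : Fin 7 → Bool) : V :=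
  Fin.cons (n.val : ℤ) fun i => (![0, -1, -1, -2] n : ℤ) + if s i then 1 else 0

theorem exists_excCandidate {E : V} (hE : E ∈ Exc) : ∃ n s, excCandidate n s = E := by
  obtain ⟨h₁, h₂⟩ := hE
  simp [bil_eq, Kvec] at h₁ h₂
  have hcs := sq_sum_le_card_mul_sum_sq (s := Finset.univ) (f := fun i : Fin 7 => E i.succ)
  simp [Fin.sum_univ_succ] at hcs
  have hS : E 1 + (E 2 + (E 3 + (E 4 + (E 5 + (E 6 + E 7))))) = 1 - 3 * E 0 := by linarith
  have hS2 : E 1 ^ 2 + (E 2 ^ 2 + (E 3 ^ 2 + (E 4 ^ 2 + (E 5 ^ 2 + (E 6 ^ 2 + E 7 ^ 2))))) =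
      E 0 ^ 2 + 1 := by linarith
  rw [hS, hS2] at hcs
  have h0 : 0 ≤ E 0 := by nlinarith
  have h3 : E 0 ≤ 3 := by nlinarith
  obtain ⟨n, hn⟩ : ∃ n : Fin 4, (n.val : ℤ) = E 0 := ⟨⟨(E 0).toNat, by omega⟩, by simpa⟩
  obtain ⟨c, hc⟩ : ∃ c : ℤ, c = ![0, -1, -1, -2] n := ⟨_, rfl⟩
  have hsum : ∑ i : Fin 7, (E i.succ - c) * (E i.succ - c - 1) = 0 := by
    simp [Fin.sum_univ_succ]
    fin_cases n <;> simp at hn hc <;> subst hc <;> rw [← hn] at hS hS2 <;>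
      linarith
  rw [Finset.sum_eq_zero_iff_of_nonneg fun i _ => by
    rcases le_or_gt (E i.succ) c with h | h <;> nlinarith] at hsum
  refine ⟨n, fun i => decide (E i.succ = c + 1), ?_⟩
  funext i
  refine Fin.cases hn (fun i => ?_) i
  simp only [excCandidate, Fin.cons_succ, ← hc, decide_eq_true_eq]
  rcases mul_eq_zero.1 (hsum i (Finset.mem_univ _)) with h | h <;> split_ifs <;> omega

theorem excCandidate_mem_orbFinset : ∀ n s,
    bil (excCandidate n s) (excCandidate n s) = -1 → bil (excCandidate n s) Kvec = -1 →
      ∃ j, excCandidate n s ∈ orbFinset (excRep j) := by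
  simp only [bil_eq]
  decide +kernel

theorem mem_Exc_iff {E : V} : E ∈ Exc ↔ ∃ j d, act d (excRep j) = E := by
  constructor
  · intro hE
    obtain ⟨n, s, rfl⟩ := exists_excCandidate hE
    obtain ⟨j, hj⟩ := excCandidate_mem_orbFinset n s hE.1 hE.2
    obtain ⟨d, -, hd⟩ := Finset.mem_image.1 hj
    exact ⟨j, d, hd⟩
  · rintro ⟨j, d, rfl⟩
    have h : ∀ j, bil (excRep j) (excRep j) = -1 ∧ bil (excRep j) Kvec = -1 := by
      simp only [bil_eq]
      decide +kernel
    rw [← dihedralHom_apply]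
    have hd := dihedralHom_mem_W d
    refine ⟨(hd.1 _ _).trans (h j).1, ?_⟩
    conv_lhs => rw [← hd.2]
    exact (hd.1 _ _).trans (h j).2

theorem orbs_range_dihedralHom :
    orbs dihedralHom.range = Set.range fun j => orb dihedralHom.range (excRep j) := by
  ext S
  constructor
  · rintro ⟨E, hE, rfl⟩
    obtain ⟨j, d, rfl⟩ := mem_Exc_iff.1 hE
    exact ⟨j, (orb_act d _).symm⟩
  · rintro ⟨j, rfl⟩
    exact ⟨excRep j, mem_Exc_iff.2 ⟨j, 1, rfl⟩, rfl⟩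

theorem orb_excRep_injective :
    Function.Injective fun j => orb dihedralHom.range (excRep j) := by
  intro i j h
  simp only [orb_range_dihedralHom] at h
  exact orbFinset_excRep_injective (Finset.coe_injective h)

theorem ncard_orb_excRep (j : Fin 4) :
    (orb dihedralHom.range (excRep j)).ncard = ![6, 30, 10, 10] j := by
  rw [orb_range_dihedralHom, Set.ncard_coe_finset, card_orbFinset_excRep]

theorem ncard_orbs : (orbs dihedralHom.range).ncard = 4 := by
  rw [orbs_range_dihedralHom, ← Set.image_univ, Set.ncard_image_of_injective _ orb_excRep_injective,
    Set.ncard_univ, Nat.card_fin]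

theorem ncard_orbs_of_ncard (k : ℕ) :
    {S ∈ orbs dihedralHom.range | S.ncard = k}.ncard =
      (Finset.univ.filter fun j : Fin 4 => (![6, 30, 10, 10] j : ℕ) = k).card := by
  have h : {S ∈ orbs dihedralHom.range | S.ncard = k} =
      (fun j => orb dihedralHom.range (excRep j)) ''
        (Finset.univ.filter fun j : Fin 4 => (![6, 30, 10, 10] j : ℕ) = k) := by
    rw [orbs_range_dihedralHom]
    ext S
    constructor
    · rintro ⟨⟨j, rfl⟩, hj⟩
      exact ⟨j, by simpa [ncard_orb_excRep] using hj, rfl⟩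
    · rintro ⟨j, hj, rfl⟩
      exact ⟨⟨j, rfl⟩, by simpa [ncard_orb_excRep] using hj⟩
  rw [h, Set.ncard_image_of_injective _ orb_excRep_injective, Set.ncard_coe_finset]

theorem ncard_orb_mul_card_stab (G : Subgroup LatAut) (E : V) :
    (orb G E).ncard * Nat.card (stab G E) = Nat.card G := by
  have h₁ : orb G E = MulAction.orbit G E := by
    ext v
    exact ⟨fun ⟨g, hg, h⟩ => ⟨⟨g, hg⟩, h⟩, fun ⟨g, h⟩ => ⟨g, g.2, h⟩⟩
  have h₂ : (stab G E).subgroupOf G = MulAction.stabilizer G E := by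
    ext g
    exact ⟨fun h => h.2, fun h => ⟨g.2, h⟩⟩
  have h₃ : stab G E ≤ G := fun g hg => hg.1
  rw [← Nat.card_congr (Subgroup.subgroupOfEquivOfLe h₃).toEquiv, h₂, h₁, ← Nat.card_coe_set_eq,
    ← Nat.card_prod]
  exact Nat.card_congr (MulAction.orbitProdStabilizerEquivGroup G E)

theorem card_range_dihedralHom : Nat.card dihedralHom.range = 30 := by
  rw [← Nat.card_congr (MonoidHom.ofInjective dihedralHom_injective).toEquiv,
    DihedralGroup.nat_card]

theorem minimalAction : MinimalAction dihedralHom.range := by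
  intro E hE h
  obtain ⟨j, d, rfl⟩ := mem_Exc_iff.1 hE
  have key : ∀ j, ∃ c, excRep j ≠ act c (excRep j) ∧ bil (excRep j) (act c (excRep j)) ≠ 0 := by
    simp only [bil_eq]
    decide +kernel
  obtain ⟨c, hc, hc'⟩ := key j
  rw [orb_act, orb_range_dihedralHom] at h
  exact hc' (h _ (Finset.mem_image.2 ⟨1, Finset.mem_univ _, rfl⟩) _
    (Finset.mem_image.2 ⟨c, Finset.mem_univ _, rfl⟩) hc)

theorem not_exists_fixed_conic :
    ¬ ∃ C, IsConic C ∧ ∀ g ∈ dihedralHom.range, g C = C := by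
  rintro ⟨C, ⟨h₁, h₂⟩, hC⟩
  have hrot : rotFun C = C := (dihedralHom_apply (.r 1) C).symm.trans (hC _ ⟨_, rfl⟩)
  have hrefl : reflFun C = C := (dihedralHom_apply (.sr 0) C).symm.trans (hC _ ⟨_, rfl⟩)
  simp [rotFun, reflFun, funext_iff, Fin.forall_fin_succ] at hrot hrefl
  simp [bil_eq, Kvec] at h₁ h₂
  have hval : C 0 = 3 ∧ C 1 = -1 ∧ C 2 = -1 ∧ C 3 = -1 ∧ C 4 = -1 ∧ C 5 = -1 ∧ C 6 = -1 ∧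
      C 7 = -1 := by omega
  obtain ⟨c0, c1, c2, c3, c4, c5, c6, c7⟩ := hval
  rw [c0, c1, c2, c3, c4, c5, c6, c7] at h₁
  norm_num at h₁

/-! ### Cohomology -/

section Cohomology

variable {H : Subgroup LatAut} {f : H → V}

theorem bil_cocycle_mul (hW : H ≤ W) (hf : ∀ g h, f (g * h) = (g : LatAut) (f h) + f g)
    (g h : H) (b : V) : bil (f (g * h)) b = bil (f h) (g⁻¹ • b) + bil (f g) b := by
  rw [hf, bil_add_left, bil_apply_inv (hW g.2)]
  rfl

theorem bil_cocycle_eq_zero_of_smul_eq [Finite H] (hW : H ≤ W)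
    (hf : ∀ g h, f (g * h) = (g : LatAut) (f h) + f g) {k : H} {b : V} (hk : k • b = b) :
    bil (f k) b = 0 := by
  have hone : bil (f 1) b = 0 := by
    have := bil_cocycle_mul hW hf 1 1 b
    rw [mul_one, inv_one, one_smul] at this
    omega
  have hpow : ∀ n : ℕ, bil (f (k ^ n)) b = n * bil (f k) b := by
    intro n
    induction n with
    | zero => simpa using hone
    | succ n ih =>
      rw [pow_succ', bil_cocycle_mul hW hf, inv_smul_eq_iff.2 hk.symm, ih]
      push_cast
      ring
  have := hpow (orderOf k)
  rw [pow_orderOf_eq_one, hone] at this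
  simpa [(orderOf_pos k).ne'] using this.symm

theorem exists_bil_cocycle_eq_sub [Finite H] (hW : H ≤ W)
    (hf : ∀ g h, f (g * h) = (g : LatAut) (f h) + f g) :
    ∃ u : V → ℤ, ∀ (g : H) (b : V), bil (f g) b = u b - u (g⁻¹ • b) := by
  let c (b : V) : V := (Quotient.mk (MulAction.orbitRel H V) b).out
  have hc (b : V) : ∃ h : H, h • c b = b :=
    (MulAction.orbitRel H V).symm (Quotient.mk_out (s := MulAction.orbitRel H V) b)
  choose h hh using hc
  refine ⟨fun b => bil (f (h b)) b, fun g b => ?_⟩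
  have hcg : c (g⁻¹ • b) = c b :=
    congrArg Quotient.out (Quotient.sound (s := MulAction.orbitRel H V) ⟨g⁻¹, rfl⟩)
  have hgb : (g * h (g⁻¹ • b)) • c b = b := by
    rw [mul_smul, ← hcg, hh, smul_inv_smul]
  have hinv : (h b)⁻¹ • b = c b := inv_smul_eq_iff.2 (hh b).symm
  have hstab : ((h b)⁻¹ * (g * h (g⁻¹ • b))) • c b = c b := by rw [mul_smul, hgb, hinv]
  have h₁ := bil_cocycle_mul hW hf (h b) ((h b)⁻¹ * (g * h (g⁻¹ • b))) b
  rw [mul_inv_cancel_left, hinv, bil_cocycle_eq_zero_of_smul_eq hW hf hstab,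
    bil_cocycle_mul hW hf] at h₁
  linarith

/-- If the identity of the lattice is a sum of rank one endomorphisms `x ↦ ⟨x, b⟩ a` over an
`H`-stable finite set of pairs `(a, b)`, that is, if the lattice is a direct summand of a
permutation module, then its first cohomology vanishes. -/
theorem subsingleton_H1_of_sum_bil_smul [Finite H] (hW : H ≤ W) (T : Finset (V × V))
    (hT : ∀ g ∈ H, ∀ t ∈ T, g • t ∈ T) (hid : ∀ x, ∑ t ∈ T, bil x t.2 • t.1 = x) :
    Subsingleton (groupCohomology.H1 (Rep.of (rep H))) := by
  refine subsingleton_of_forall_eq 0 fun y => ?_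
  induction y using groupCohomology.H1_induction_on with | _ f
  rw [groupCohomology.H1π_eq_zero_iff]
  have hf : ∀ g h, f (g * h) = (g : LatAut) (f h) + f g :=
    (groupCohomology.mem_cocycles₁_iff f.1).1 f.2
  obtain ⟨u, hu⟩ := exists_bil_cocycle_eq_sub (f := f) hW hf
  refine ⟨-∑ t ∈ T, u t.2 • t.1, funext fun g => ?_⟩
  have hsum : ∑ t ∈ T, u (g⁻¹ • t.2) • t.1 = (g : LatAut) (∑ t ∈ T, u t.2 • t.1) := by
    rw [map_sum]
    refine Finset.sum_bij' (fun t _ => (g : LatAut)⁻¹ • t) (fun t _ => (g : LatAut) • t)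
      (hT _ (H.inv_mem g.2)) (hT _ g.2) (fun t _ => smul_inv_smul _ t)
      (fun t _ => inv_smul_smul _ t) fun t _ => ?_
    rw [map_smul]
    exact congrArg (u (g⁻¹ • t.2) • ·) (smul_inv_smul (g : LatAut) t.1).symm
  change (g : LatAut) (-∑ t ∈ T, u t.2 • t.1) - (-∑ t ∈ T, u t.2 • t.1) = f g
  rw [map_neg, ← hsum, ← hid (f g)]
  simp only [hu, sub_smul, Finset.sum_sub_distrib]
  abel

end Cohomology

/-- Representatives of the orbits of pairs decomposing the identity of the lattice. -/
def pairRep : Fin 3 → V × V :=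
  ![(-3 • Kvec, Kvec),
    (![0, 0, 0, 0, 0, 0, 0, -1], ![1, 0, 0, 0, 0, 0, -1, -1]),
    (![1, -1, -1, 0, 0, 0, 0, 0], ![4, -1, -1, -2, -1, -1, -2, -2])]

/-- A stable set of pairs decomposing the identity of the lattice. -/
def pairs : Finset (V × V) :=
  Finset.univ.image fun p : DihedralGroup 15 × Fin 3 =>
    (act p.1 (pairRep p.2).1, act p.1 (pairRep p.2).2)

theorem smul_mem_pairs {g : LatAut} (hg : g ∈ dihedralHom.range) {t : V × V} (ht : t ∈ pairs) :
    g • t ∈ pairs := by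
  obtain ⟨d, rfl⟩ := hg
  obtain ⟨⟨c, j⟩, -, rfl⟩ := Finset.mem_image.1 ht
  refine Finset.mem_image.2 ⟨(d * c, j), Finset.mem_univ _, ?_⟩
  simp only [← dihedralHom_apply, map_mul]
  rfl

theorem sum_bil_smul_eq_of_single {T : Finset (V × V)}
    (h : ∀ i : Fin 8, ∑ t ∈ T, bil (Pi.single i 1) t.2 • t.1 = Pi.single i 1) (x : V) :
    ∑ t ∈ T, bil x t.2 • t.1 = x := by
  let θ : V →ₗ[ℤ] V :=
    { toFun x := ∑ t ∈ T, bil x t.2 • t.1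
      map_add' x y := by simp only [bil_add_left, add_smul, Finset.sum_add_distrib]
      map_smul' c x := by
        simp only [bil_smul_left, mul_smul, Finset.smul_sum, RingHom.id_apply] }
  have hθ : θ = LinearMap.id := (Pi.basisFun ℤ (Fin 8)).ext fun i => by
    rw [Pi.basisFun_apply]
    exact h i
  exact LinearMap.congr_fun hθ x

theorem sum_pairs (x : V) : ∑ t ∈ pairs, bil x t.2 • t.1 = x := by
  refine sum_bil_smul_eq_of_single ?_ x
  simp only [bil_eq]
  decide +kernel

theorem condH1 : CondH1 dihedralHom.range := by
  intro H hH
  have : Finite dihedralHom.range := Finite.of_surjective _ dihedralHom.rangeRestrict_surjective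
  have : Finite H := Finite.of_injective _ (Subgroup.inclusion_injective hH)
  exact subsingleton_H1_of_sum_bil_smul (hH.trans range_dihedralHom_le_W) pairs
    (fun g hg t ht => smul_mem_pairs (hH hg) ht) sum_pairs

theorem exists_dp2_D15 :
    ∃ G : Subgroup LatAut, G ≤ W ∧
      Nonempty (G ≃* DihedralGroup 15) ∧
      (orbs G).ncard = 4 ∧
      {S ∈ orbs G | S.ncard = 6}.ncard = 1 ∧
      {S ∈ orbs G | S.ncard = 10}.ncard = 2 ∧
      {S ∈ orbs G | S.ncard = 30}.ncard = 1 ∧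
      (∀ E ∈ Exc,
        ((orb G E).ncard = 6 → IsCyclic (stab G E) ∧ Nat.card (stab G E) = 5) ∧
        ((orb G E).ncard = 10 → IsCyclic (stab G E) ∧ Nat.card (stab G E) = 3) ∧
        ((orb G E).ncard = 30 → stab G E = ⊥)) ∧
      MinimalAction G ∧
      (¬ ∃ C, IsConic C ∧ ∀ g ∈ G, g C = C) ∧
      CondH1 G := by
  refine ⟨dihedralHom.range, range_dihedralHom_le_W,
    ⟨(MonoidHom.ofInjective dihedralHom_injective).symm⟩, ncard_orbs,
    (ncard_orbs_of_ncard 6).trans (by decide), (ncard_orbs_of_ncard 10).trans (by decide),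
    (ncard_orbs_of_ncard 30).trans (by decide), fun E _ => ?_, minimalAction,
    not_exists_fixed_conic, condH1⟩
  have h := ncard_orb_mul_card_stab dihedralHom.range E
  rw [card_range_dihedralHom] at h
  refine ⟨fun h6 => ?_, fun h10 => ?_, fun h30 => ?_⟩
  · have h5 : Nat.card (stab dihedralHom.range E) = 5 := by rw [h6] at h; omega
    have : Fact (Nat.Prime 5) := ⟨Nat.prime_five⟩
    exact ⟨isCyclic_of_prime_card h5, h5⟩
  · have h3 : Nat.card (stab dihedralHom.range E) = 3 := by rw [h10] at h; omega
    have : Fact (Nat.Prime 3) := ⟨Nat.prime_three⟩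
    exact ⟨isCyclic_of_prime_card h3, h3⟩
  · refine Subgroup.card_eq_one.1 ?_
    rw [h30] at h
    omega

end
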